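/- arXiv:2510.05380 — 2 statements merged into one kernel-verified Lean document; each statement's English description precedes it below -/
import Mathlib

section
/- Let A ⊆ P(I) be a finite poset under inclusion in which every chain has length at most 1, let H_c : E_c → ℝ (c ∈ A) be Hamiltonians, let a ∈ A be a colinear point with witness a↓ ∈ A (so a↓ ⊊ a and a is maximal), and set B = A∖{a}. Define ψ : L(B) → L(A) by ψ(Q)_b = Q_b for b ≠ a and ψ(Q)_a(x) = Q_{a↓}(x_{a↓}) · e^{−H_a(x)} / Σ_{z∈E_a, z_{a↓} = x_{a↓}} e^{−H_a(z)} for x ∈ E_a. Define 𝓛 : L(B) → ℝ by 𝓛(Q) = Σ_{b∈B} c_B(b) ( Σ_{x∈E_b} Q_b(x) H_b(x) − S(Q_b) ) − Σ_{y∈E_{a↓}} Q_{a↓}(y) ln Σ_{z∈E_a, z_{a↓} = y} e^{−H_a(z) + H_{a↓}(y)}. Then ψ restricts to a bijection between the critical points of 𝓛 in L(B)° and the critical points of BT_{A,H} in L(A)°, and also to a bijection between the global minimizers of 𝓛 over L(B) and the global minimizers of BT_{A,H} over L(A). -/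
/- Setup: `I` a finite index set, `E i` nonempty finite sets of values, `A : Finset (Finset I)`
a collection of subsets of `I` ordered by inclusion.  For `a : Finset I`,
`Ea E a = ∏_{i ∈ a} E i`, with coordinate projections `proj`.  A family of "local functions"
indexed by `A` is an element of `Fam E A`. -/

abbrev Ea {I : Type} (E : I → Type) (a : Finset I) : Type := (i : a) → E i

def proj {I : Type} (E : I → Type) {a b : Finset I} (h : b ⊆ a) (x : Ea E a) : Ea E b :=
  fun i => x ⟨i, h i.2⟩

abbrev Fam {I : Type} (E : I → Type) (A : Finset (Finset I)) : Type :=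
  (a : A) → Ea E (a : Finset I) → ℝ

-- The local polytope `L(A)`: families of probability distributions compatible by marginalization.
open Classical in
def MemL {I : Type} (E : I → Type) [∀ i, Fintype (E i)] (A : Finset (Finset I))
    (Q : Fam E A) : Prop :=
  (∀ a : A, (∀ x, 0 ≤ Q a x) ∧ (∑ x, Q a x) = 1) ∧
  (∀ (a b : A) (h : (b : Finset I) ⊆ (a : Finset I)) (x : Ea E (b : Finset I)),
    Q b x = ∑ y ∈ Finset.univ.filter (fun y : Ea E (a : Finset I) => proj E h y = x), Q a y)

-- The interior `L(A)°`: members of `L(A)` with all distributions strictly positive.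
def MemLInt {I : Type} (E : I → Type) [∀ i, Fintype (E i)] (A : Finset (Finset I))
    (Q : Fam E A) : Prop :=
  MemL E A Q ∧ ∀ (a : A) (x : Ea E (a : Finset I)), 0 < Q a x

-- The tangent space `TL(A)` of the local polytope.
open Classical in
def MemT {I : Type} (E : I → Type) [∀ i, Fintype (E i)] (A : Finset (Finset I))
    (u : Fam E A) : Prop :=
  (∀ a : A, (∑ x, u a x) = 0) ∧
  (∀ (a b : A) (h : (b : Finset I) ⊆ (a : Finset I)) (x : Ea E (b : Finset I)),
    u b x = ∑ y ∈ Finset.univ.filter (fun y : Ea E (a : Finset I) => proj E h y = x), u a y)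

-- `μ` is the Möbius function of the poset `A` (ordered by inclusion): `μ x y = 0` for
-- `x, y ∈ A` with `¬ y ⊆ x`, and `∑_{b ∈ A, c ⊆ b ⊆ a} μ b c = δ_{a,c}` for `c ⊆ a` in `A`.
open Classical in
def IsMobius {I : Type} (A : Finset (Finset I)) (μ : Finset I → Finset I → ℤ) : Prop :=
  (∀ x ∈ A, ∀ y ∈ A, ¬ y ⊆ x → μ x y = 0) ∧
  (∀ a ∈ A, ∀ c ∈ A, c ⊆ a →
    (∑ b ∈ A.filter (fun b => c ⊆ b ∧ b ⊆ a), μ b c) = if a = c then 1 else 0)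

-- `c_A(x) = ∑_{b ∈ A, b ⊇ x} μ_A(b, x)`.
open Classical in
noncomputable def coefC {I : Type} (A : Finset (Finset I)) (μ : Finset I → Finset I → ℤ)
    (x : Finset I) : ℤ :=
  ∑ b ∈ A.filter (fun b => x ⊆ b), μ b x

-- Shannon entropy `S(Q) = −∑_x Q x ln (Q x)` (with `0 ln 0 = 0`, as `Real.log 0 = 0`).
noncomputable def entropy {α : Type*} [Fintype α] (Q : α → ℝ) : ℝ :=
  -∑ x, Q x * Real.log (Q x)

-- The generalized Bethe free energy
-- `BT_{A,H}(Q) = ∑_{a ∈ A} c_A(a) (∑_x Q_a(x) H_a(x) − S(Q_a))`.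
open Classical in
noncomputable def BT {I : Type} (E : I → Type) [∀ i, Fintype (E i)]
    (A : Finset (Finset I)) (μ : Finset I → Finset I → ℤ)
    (H : (c : Finset I) → Ea E c → ℝ) (Q : Fam E A) : ℝ :=
  ∑ a : A, (coefC A μ (a : Finset I) : ℝ) *
    ((∑ x, Q a x * H (a : Finset I) x) - entropy (Q a))

-- A critical point of a functional `F` on `L(A)°`: a point `Q ∈ L(A)°` at which the
-- derivative at `t = 0` of `t ↦ F(Q + t u)` vanishes for every tangent vector `u ∈ TL(A)`.
open Classical in
def IsCritical {I : Type} (E : I → Type) [∀ i, Fintype (E i)]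
    (A : Finset (Finset I)) (F : Fam E A → ℝ) (Q : Fam E A) : Prop :=
  MemLInt E A Q ∧
  ∀ u : Fam E A, MemT E A u →
    deriv (fun t : ℝ => F (fun a x => Q a x + t * u a x)) 0 = 0

-- A global minimizer of `F` over `L(A)`.
def IsMinimizer {I : Type} (E : I → Type) [∀ i, Fintype (E i)]
    (A : Finset (Finset I)) (F : Fam E A → ℝ) (Q : Fam E A) : Prop :=
  MemL E A Q ∧ ∀ Q' : Fam E A, MemL E A Q' → F Q ≤ F Q'

-- Every chain of `A` has length at most 1: there is no chain `x ⊂ y ⊂ z` in `A`.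
def ChainsShort {I : Type} (A : Finset (Finset I)) : Prop :=
  ∀ x ∈ A, ∀ y ∈ A, ∀ z ∈ A, x ⊂ y → y ⊂ z → False

-- For a colinear point `a ∈ A` with witness `aDn`, the map `ψ : L(A∖{a}) → L(A)`:
-- `ψ(Q)_b = Q_b` for `b ≠ a`, and
-- `ψ(Q)_a(x) = Q_{aDn}(x_{aDn}) e^{−H_a(x)} / ∑_{z ∈ E_a, z_{aDn} = x_{aDn}} e^{−H_a(z)}`.
open Classical in
noncomputable def psiMap {I : Type} [DecidableEq I] (E : I → Type) [∀ i, Fintype (E i)]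
    (A : Finset (Finset I)) (a aDn : Finset I) (hsub : aDn ⊆ a) (hDn : aDn ∈ A.erase a)
    (H : (c : Finset I) → Ea E c → ℝ) (Q : Fam E (A.erase a)) : Fam E A :=
  fun c x =>
    if h : (c : Finset I) = a then
      have hsub' : aDn ⊆ (c : Finset I) := by rw [h]; exact hsub
      Q ⟨aDn, hDn⟩ (fun i => x ⟨i, hsub' i.2⟩) * Real.exp (-(H (c : Finset I) x)) /
        ∑ z ∈ Finset.univ.filter (fun z : Ea E (c : Finset I) =>
            ∀ i : {w // w ∈ aDn}, z ⟨i, hsub' i.2⟩ = x ⟨i, hsub' i.2⟩),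
          Real.exp (-(H (c : Finset I) z))
    else Q ⟨c, Finset.mem_erase.2 ⟨h, c.2⟩⟩ x

-- The functional `𝓛` on `L(A∖{a})`:
-- `𝓛(Q) = ∑_{b ∈ B} c_B(b)(E_{Q_b}[H_b] − S(Q_b))
--          − ∑_y Q_{aDn}(y) ln ∑_{z ∈ E_a, z_{aDn} = y} e^{−H_a(z) + H_{aDn}(y)}`.
open Classical in
noncomputable def Lfun {I : Type} [DecidableEq I] (E : I → Type) [∀ i, Fintype (E i)]
    (A : Finset (Finset I)) (a aDn : Finset I) (hsub : aDn ⊆ a) (hDn : aDn ∈ A.erase a)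
    (μB : Finset I → Finset I → ℤ) (H : (c : Finset I) → Ea E c → ℝ)
    (Q : Fam E (A.erase a)) : ℝ :=
  BT E (A.erase a) μB H Q -
    ∑ y : Ea E aDn, Q ⟨aDn, hDn⟩ y *
      Real.log (∑ z ∈ Finset.univ.filter (fun z : Ea E a =>
          ∀ i : {w // w ∈ aDn}, z ⟨i, hsub i.2⟩ = y i),
        Real.exp (-(H a z) + H aDn y))

section helpers
open Classical

noncomputable def marg {X Y : Type} [Fintype X] (p : X → Y) (q : X → ℝ) (y : Y) : ℝ :=
  ∑ x ∈ Finset.univ.filter (fun x => p x = y), q x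

noncomputable def kfun {X Y : Type} [Fintype X] [Fintype Y] (p : X → Y) (h : X → ℝ)
    (q : X → ℝ) (m : Y → ℝ) : ℝ :=
  (∑ x, q x * (h x + Real.log (q x))) - (∑ y, m y * Real.log (m y))
    + ∑ y, m y * Real.log (marg p (fun x => Real.exp (-(h x))) y)

noncomputable def lift' {X Y : Type} [Fintype X] (p : X → Y) (h : X → ℝ) (m : Y → ℝ) (x : X) : ℝ :=
  m (p x) * Real.exp (-(h x)) / marg p (fun x => Real.exp (-(h x))) (p x)

section abs
set_option linter.unusedSectionVars false
variable {X Y : Type} [Fintype X] [Fintype Y] (p : X → Y) (h : X → ℝ)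

lemma marg_sum (q : X → ℝ) (f : Y → ℝ) : ∑ y, marg p q y * f y = ∑ x, q x * f (p x) := by
  unfold marg
  rw [← Finset.sum_fiberwise (s := Finset.univ) (g := p)]
  refine Finset.sum_congr rfl fun y _ => ?_
  rw [Finset.sum_mul]
  refine Finset.sum_congr rfl fun x hx => ?_
  rw [(Finset.mem_filter.1 hx).2]

lemma marg_sum_one (q : X → ℝ) : ∑ y, marg p q y = ∑ x, q x := by
  simpa using marg_sum p q (fun _ => 1)

lemma Z_pos (x : X) : 0 < marg p (fun x => Real.exp (-(h x))) (p x) := by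
  unfold marg
  exact Finset.sum_pos (fun _ _ => Real.exp_pos _) ⟨x, by simp⟩

lemma marg_lift (hp : Function.Surjective p) (m : Y → ℝ) : marg p (lift' p h m) = m := by
  funext y
  obtain ⟨x, rfl⟩ := hp y
  have hz := (Z_pos p h x).ne'
  have : marg p (lift' p h m) (p x) = ∑ z ∈ Finset.univ.filter (fun z => p z = p x),
      m (p x) / marg p (fun x => Real.exp (-(h x))) (p x) * Real.exp (-(h z)) := by
    unfold marg
    refine Finset.sum_congr rfl fun z hz => ?_
    rw [lift', (Finset.mem_filter.1 hz).2]
    unfold marg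
    ring
  rw [this, ← Finset.mul_sum]
  change m (p x) / _ * marg p (fun x => Real.exp (-(h x))) (p x) = _
  field_simp

lemma lift_nonneg (m : Y → ℝ) (hm : ∀ y, 0 ≤ m y) (x : X) : 0 ≤ lift' p h m x := by
  have := Z_pos p h x
  have := hm (p x)
  unfold lift'; positivity

lemma lift_pos (m : Y → ℝ) (hm : ∀ y, 0 < m y) (x : X) : 0 < lift' p h m x := by
  have := Z_pos p h x
  have := hm (p x)
  unfold lift'; positivity

lemma log_lift (m : Y → ℝ) (x : X) (hm : m (p x) ≠ 0) : Real.log (lift' p h m x) =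
    Real.log (m (p x)) - h x - Real.log (marg p (fun x => Real.exp (-(h x))) (p x)) := by
  have := (Z_pos p h x).ne'
  unfold lift'
  rw [Real.log_div (by positivity) this, Real.log_mul hm (Real.exp_pos _).ne', Real.log_exp]
  ring

lemma kl_term (q r : ℝ) (hq : 0 ≤ q) (hr : 0 ≤ r) (h0 : r = 0 → q = 0) :
    q - r ≤ q * (Real.log q - Real.log r) ∧
    (q * (Real.log q - Real.log r) = q - r → q = r) := by
  rcases hq.eq_or_lt with rfl | hq
  · simp; constructor
    · linarith
    · intro h; linarith
  have hr : 0 < r := lt_of_le_of_ne hr (fun h => hq.ne' (h0 h.symm))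
  have e : Real.log (r / q) = Real.log r - Real.log q := Real.log_div hr.ne' hq.ne'
  have hrq : 0 < r / q := by positivity
  have e2 : q * (r / q) = r := by field_simp
  constructor
  · have := Real.log_le_sub_one_of_pos hrq
    nlinarith
  · intro h
    by_contra hne
    have := Real.log_lt_sub_one_of_pos hrq (by
      intro h1; rw [div_eq_one_iff_eq hq.ne'] at h1; exact hne h1.symm)
    nlinarith

lemma kfun_eq (q : X → ℝ) (hq : ∀ x, 0 ≤ q x) :
    kfun p h q (marg p q) =
      ∑ x, q x * (Real.log (q x) - Real.log (lift' p h (marg p q) x)) := by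
  unfold kfun
  rw [marg_sum, marg_sum, ← Finset.sum_sub_distrib, ← Finset.sum_add_distrib]
  refine Finset.sum_congr rfl fun x _ => ?_
  by_cases h0 : q x = 0
  · simp [h0]
  · rw [log_lift]
    · ring
    · have : q x ≤ marg p q (p x) :=
        Finset.single_le_sum (f := q) (fun i _ => hq i) (by simp)
      have := lt_of_le_of_ne (hq x) (Ne.symm h0)
      linarith

lemma lift_zero (q : X → ℝ) (hq : ∀ x, 0 ≤ q x) (x : X) (h0 : lift' p h (marg p q) x = 0) :
    q x = 0 := by
  have h1 := (Z_pos p h x).ne'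
  have : q x ≤ marg p q (p x) :=
        Finset.single_le_sum (f := q) (fun i _ => hq i) (by simp)
  unfold lift' at h0
  have : marg p q (p x) = 0 := by
    simpa [h1, Real.exp_ne_zero] using h0
  linarith [hq x]

lemma kfun_nonneg (hp : Function.Surjective p) (q : X → ℝ) (hq : ∀ x, 0 ≤ q x) :
    0 ≤ kfun p h q (marg p q) ∧
    (kfun p h q (marg p q) = 0 → q = lift' p h (marg p q)) := by
  have hm : ∀ y, 0 ≤ marg p q y := fun y => Finset.sum_nonneg fun i _ => hq i
  have key := fun x => kl_term (q x) (lift' p h (marg p q) x) (hq x) (lift_nonneg p h _ hm x)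
    (lift_zero p h q hq x)
  have hs : ∑ x, (q x - lift' p h (marg p q) x) = 0 := by
    rw [Finset.sum_sub_distrib, ← marg_sum_one p q, ← marg_sum_one p (lift' p h (marg p q)),
      marg_lift p h hp]
    simp
  rw [kfun_eq p h q hq]
  constructor
  · rw [← hs]
    exact Finset.sum_le_sum fun x _ => (key x).1
  · intro h0
    have := (Finset.sum_eq_sum_iff_of_le (s := Finset.univ) fun x _ => (key x).1).1 (hs.trans h0.symm)
    funext x
    exact (key x).2 (this x (Finset.mem_univ _)).symm

lemma kfun_lift (hp : Function.Surjective p) (m : Y → ℝ) (hm : ∀ y, 0 ≤ m y) :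
    kfun p h (lift' p h m) m = 0 := by
  have := kfun_eq p h (lift' p h m) (lift_nonneg p h m hm)
  rw [marg_lift p h hp] at this
  rw [this]; simp

lemma hasDeriv_xlogx (q u : ℝ) (hq : 0 < q) :
    HasDerivAt (fun t : ℝ => (q + t * u) * Real.log (q + t * u)) (u * (Real.log q + 1)) 0 := by
  have h1 : HasDerivAt (fun t : ℝ => q + t * u) u 0 := by
    simpa using ((hasDerivAt_id (0:ℝ)).mul_const u).const_add q
  have h2 := h1.mul (h1.log (by simpa using hq.ne'))
  have e : u * Real.log (q + 0 * u) + (q + 0 * u) * (u / (q + 0 * u)) = u * (Real.log q + 1) := by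
    have := hq.ne'
    rw [zero_mul, add_zero]
    field_simp
  rw [e] at h2
  exact h2

lemma hasDeriv_lin (q u c : ℝ) :
    HasDerivAt (fun t : ℝ => (q + t * u) * c) (u * c) 0 := by
  have h1 : HasDerivAt (fun t : ℝ => q + t * u) u 0 := by
    simpa using ((hasDerivAt_id (0:ℝ)).mul_const u).const_add q
  exact h1.mul_const c

lemma kfun_deriv (q u : X → ℝ) (hq : ∀ x, 0 < q x) (hm : ∀ y, 0 < marg p q y) :
    HasDerivAt (fun t : ℝ => kfun p h (fun x => q x + t * u x)
        (fun y => marg p q y + t * marg p u y))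
      (∑ x, u x * (Real.log (q x) - Real.log (lift' p h (marg p q) x))) 0 := by
  have h1 : HasDerivAt (fun t : ℝ => kfun p h (fun x => q x + t * u x)
        (fun y => marg p q y + t * marg p u y))
      ((∑ x, (u x * h x + u x * (Real.log (q x) + 1)))
        - (∑ y, marg p u y * (Real.log (marg p q y) + 1))
        + ∑ y, marg p u y * Real.log (marg p (fun x => Real.exp (-(h x))) y)) 0 := by
    unfold kfun
    refine ((HasDerivAt.fun_sum fun x _ => ?_).sub (HasDerivAt.fun_sum fun y _ => ?_)).add
      (HasDerivAt.fun_sum fun y _ => ?_)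
    · simp only [mul_add (_ + _ * _)]
      exact (hasDeriv_lin _ _ _).add (hasDeriv_xlogx _ _ (hq x))
    · exact hasDeriv_xlogx _ _ (hm y)
    · exact hasDeriv_lin _ _ _
  convert h1 using 1
  rw [marg_sum, marg_sum p u (fun y => Real.log (marg p (fun x => Real.exp (-(h x))) y)),
    ← Finset.sum_sub_distrib, ← Finset.sum_add_distrib]
  refine Finset.sum_congr rfl fun x _ => ?_
  rw [log_lift _ _ _ _ (hm _).ne']
  ring

lemma log_mono_eq (q r : X → ℝ) (hq : ∀ x, 0 < q x) (hr : ∀ x, 0 < r x)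
    (hs : ∑ x, (q x - r x) * (Real.log (q x) - Real.log (r x)) = 0) : q = r := by
  have hn : ∀ x, 0 ≤ (q x - r x) * (Real.log (q x) - Real.log (r x)) := by
    intro x
    rcases le_total (q x) (r x) with h | h
    · exact mul_nonneg_of_nonpos_of_nonpos (by linarith)
        (by linarith [Real.log_le_log (hq x) h])
    · exact mul_nonneg (by linarith) (by linarith [Real.log_le_log (hr x) h])
  have := (Finset.sum_eq_zero_iff_of_nonneg (fun x _ => hn x)).1 hs
  funext x
  rcases mul_eq_zero.1 (this x (Finset.mem_univ _)) with h | h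
  · linarith
  · exact Real.log_injOn_pos (hq x) (hr x) (by linarith)

end abs

section fam
set_option linter.unusedSectionVars false
variable {I : Type} {E : I → Type} [∀ i, Fintype (E i)]

def Compat (A : Finset (Finset I)) (Q : Fam E A) : Prop :=
  ∀ (a b : A) (h : (b : Finset I) ⊆ (a : Finset I)), Q b = marg (proj E h) (Q a)

lemma memL_iff (A : Finset (Finset I)) (Q : Fam E A) : MemL E A Q ↔
    (∀ a : A, (∀ x, 0 ≤ Q a x) ∧ (∑ x, Q a x) = 1) ∧ Compat A Q := by
  simp only [MemL, Compat, funext_iff, marg]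

lemma memT_iff (A : Finset (Finset I)) (Q : Fam E A) : MemT E A Q ↔
    (∀ a : A, (∑ x, Q a x) = 0) ∧ Compat A Q := by
  simp only [MemT, Compat, funext_iff, marg]

lemma mobius_val {A : Finset (Finset I)} (hchain : ChainsShort A) {μ : Finset I → Finset I → ℤ}
    (hμ : IsMobius A μ) {x y : Finset I} (hx : x ∈ A) (hy : y ∈ A) (hxy : y ⊆ x) :
    μ x y = if x = y then 1 else -1 := by
  have hyy : μ y y = 1 := by
    have := hμ.2 y hy y hy subset_rfl
    rw [show A.filter (fun b => y ⊆ b ∧ b ⊆ y) = {y} from ?_] at this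
    · simpa using this
    · ext b
      simp only [Finset.mem_filter, Finset.mem_singleton]
      constructor
      · rintro ⟨_, h1, h2⟩; exact h2.antisymm h1
      · rintro rfl; exact ⟨hy, subset_rfl, subset_rfl⟩
  by_cases e : x = y
  · subst e; simpa using hyy
  · have := hμ.2 x hx y hy hxy
    rw [show A.filter (fun b => y ⊆ b ∧ b ⊆ x) = {y, x} from ?_,
      Finset.sum_pair (Ne.symm e), hyy, if_neg e] at this
    · rw [if_neg e]; omega
    · ext b
      simp only [Finset.mem_filter, Finset.mem_singleton, Finset.mem_insert]
      constructor
      · rintro ⟨hb, h1, h2⟩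
        by_contra hcon
        push Not at hcon
        exact hchain y hy b hb x hx (h1.ssubset_of_ne hcon.1.symm) (h2.ssubset_of_ne hcon.2)
      · rintro (rfl | rfl)
        · exact ⟨hy, subset_rfl, hxy⟩
        · exact ⟨hx, hxy, subset_rfl⟩

lemma coefC_val {A : Finset (Finset I)} (hchain : ChainsShort A) {μ : Finset I → Finset I → ℤ}
    (hμ : IsMobius A μ) {x : Finset I} (hx : x ∈ A) :
    coefC A μ x = ∑ b ∈ A.filter (fun b => x ⊆ b), if b = x then 1 else -1 := by
  unfold coefC
  refine Finset.sum_congr rfl fun b hb => ?_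
  rw [Finset.mem_filter] at hb
  exact mobius_val hchain hμ hb.1 hx hb.2

variable {A : Finset (Finset I)} {a aDn : Finset I}

def res (a : Finset I) (Q : Fam E A) : Fam E (A.erase a) :=
  fun c => Q ⟨c, Finset.mem_of_mem_erase c.2⟩

lemma fam_ext (haA : a ∈ A) {Q Q' : Fam E A} (h1 : res a Q = res a Q')
    (h2 : Q ⟨a, haA⟩ = Q' ⟨a, haA⟩) : Q = Q' := by
  funext ⟨c, hc⟩
  by_cases h : c = a
  · subst h; exact h2
  · exact congrFun h1 ⟨c, Finset.mem_erase.2 ⟨h, hc⟩⟩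

lemma exists_glue (haA : a ∈ A) (P : Fam E (A.erase a)) (q : Ea E a → ℝ) :
    ∃ Q : Fam E A, res a Q = P ∧ Q ⟨a, haA⟩ = q := by
  refine ⟨fun c => if h : (c : Finset I) = a then fun x => q (fun i => x ⟨i, h ▸ i.2⟩)
    else P ⟨c, Finset.mem_erase.2 ⟨h, c.2⟩⟩, ?_, ?_⟩
  · funext c
    have := (Finset.mem_erase.1 c.2).1
    simp [res, this]
  · simp

lemma sum_split (haA : a ∈ A) (F : A → ℝ) :
    ∑ c, F c = F ⟨a, haA⟩ + ∑ c : (A.erase a : Finset (Finset I)), F ⟨c, Finset.mem_of_mem_erase c.2⟩ := by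
  let F' : Finset I → ℝ := fun c => if h : c ∈ A then F ⟨c, h⟩ else 0
  have e1 : ∑ c, F c = ∑ c ∈ A, F' c := by
    rw [← Finset.sum_coe_sort A F']
    exact Finset.sum_congr rfl fun c _ => by simp [F']
  have e2 : ∑ c : (A.erase a : Finset (Finset I)), F ⟨c, Finset.mem_of_mem_erase c.2⟩
      = ∑ c ∈ A.erase a, F' c := by
    rw [← Finset.sum_coe_sort (A.erase a) F']
    refine Finset.sum_congr rfl fun c _ => ?_
    have := Finset.mem_of_mem_erase c.2
    simp only [F', dif_pos this]
  rw [e1, e2, ← Finset.add_sum_erase A F' haA]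
  simp [F', haA]

lemma compat_of (haA : a ∈ A) (hlt : aDn ⊂ a) (hDnB : aDn ∈ A.erase a)
    (hmax : ∀ b ∈ A, a ⊆ b → b = a) (hmin : ∀ b ∈ A, b ⊂ a → b = aDn)
    (Q : Fam E A) (h1 : Compat (A.erase a) (res a Q))
    (h2 : res a Q ⟨aDn, hDnB⟩ = marg (proj E hlt.subset) (Q ⟨a, haA⟩)) : Compat A Q := by
  rintro ⟨c, hc⟩ ⟨b, hb⟩ h
  simp only at h
  by_cases hca : c = a
  · subst hca
    by_cases hba : b = c
    · subst hba
      funext x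
      have : ∀ y : Ea E b, proj E h y = y := fun y => rfl
      simp [marg, this, Finset.filter_eq']
    · obtain rfl := hmin b hb (h.ssubset_of_ne hba)
      exact h2
  · by_cases hba : b = a
    · subst hba
      exact absurd (hmax c hc h) hca
    · exact h1 ⟨c, Finset.mem_erase.2 ⟨hca, hc⟩⟩ ⟨b, Finset.mem_erase.2 ⟨hba, hb⟩⟩ h

lemma compat_res {Q : Fam E A} (h : Compat A Q) : Compat (A.erase a) (res a Q) :=
  fun c b hcb => h ⟨c, Finset.mem_of_mem_erase c.2⟩ ⟨b, Finset.mem_of_mem_erase b.2⟩ hcb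

lemma memL_res {Q : Fam E A} (h : MemL E A Q) : MemL E (A.erase a) (res a Q) := by
  rw [memL_iff] at *
  exact ⟨fun c => h.1 ⟨c, Finset.mem_of_mem_erase c.2⟩, compat_res h.2⟩

lemma memT_res {Q : Fam E A} (h : MemT E A Q) : MemT E (A.erase a) (res a Q) := by
  rw [memT_iff] at *
  exact ⟨fun c => h.1 ⟨c, Finset.mem_of_mem_erase c.2⟩, compat_res h.2⟩

lemma psi_res (hsub : aDn ⊆ a) (hDnB : aDn ∈ A.erase a)
    (H : (c : Finset I) → Ea E c → ℝ) (P : Fam E (A.erase a)) :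
    res a (psiMap E A a aDn hsub hDnB H P) = P := by
  funext c
  have := (Finset.mem_erase.1 c.2).1
  funext x
  simp only [res, psiMap, dif_neg this]

lemma psi_a (haA : a ∈ A) (hsub : aDn ⊆ a) (hDnB : aDn ∈ A.erase a)
    (H : (c : Finset I) → Ea E c → ℝ) (P : Fam E (A.erase a)) :
    psiMap E A a aDn hsub hDnB H P ⟨a, haA⟩ = lift' (proj E hsub) (H a) (P ⟨aDn, hDnB⟩) := by
  funext x
  simp only [psiMap, lift', marg, dif_pos]
  congr 1
  refine Finset.sum_congr ?_ fun _ _ => rfl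
  ext z
  simp [proj, funext_iff]

lemma bt_eq (hchain : ChainsShort A) (haA : a ∈ A) (hlt : aDn ⊂ a) (hDnB : aDn ∈ A.erase a)
    (hmax : ∀ b ∈ A, a ⊆ b → b = a) (hmin : ∀ b ∈ A, b ⊂ a → b = aDn)
    [∀ i, Nonempty (E i)]
    (hsurj : Function.Surjective (proj E hlt.subset))
    (μA : Finset I → Finset I → ℤ) (hμA : IsMobius A μA)
    (μB : Finset I → Finset I → ℤ) (hμB : IsMobius (A.erase a) μB)
    (H : (c : Finset I) → Ea E c → ℝ) (Q : Fam E A) :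
    BT E A μA H Q = Lfun E A a aDn hlt.subset hDnB μB H (res a Q)
      + kfun (proj E hlt.subset) (H a) (Q ⟨a, haA⟩) (res a Q ⟨aDn, hDnB⟩) := by
  have hchainB : ChainsShort (A.erase a) := fun x hx y hy z hz =>
    hchain x (Finset.mem_of_mem_erase hx) y (Finset.mem_of_mem_erase hy)
      z (Finset.mem_of_mem_erase hz)
  have ca : coefC A μA a = 1 := by
    rw [coefC_val hchain hμA haA, show A.filter (fun b => a ⊆ b) = {a} from ?_]
    · simp
    · ext b
      simp only [Finset.mem_filter, Finset.mem_singleton]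
      exact ⟨fun h => hmax b h.1 h.2, by rintro rfl; exact ⟨haA, subset_rfl⟩⟩
  have cb : ∀ c ∈ A.erase a, coefC A μA c = coefC (A.erase a) μB c - if c = aDn then 1 else 0 := by
    intro c hc
    have hca := (Finset.mem_erase.1 hc).1
    have hcA := (Finset.mem_erase.1 hc).2
    rw [coefC_val hchain hμA hcA, coefC_val hchainB hμB hc, Finset.sum_filter, Finset.sum_filter,
      ← Finset.add_sum_erase A _ haA]
    have : c ⊆ a ↔ c = aDn :=
      ⟨fun h => hmin c hcA (h.ssubset_of_ne hca), by rintro rfl; exact hlt.subset⟩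
    rw [if_neg (Ne.symm hca)]
    simp only [this]
    split_ifs <;> ring
  have hZ : ∀ y : Ea E aDn, Real.log (∑ z ∈ Finset.univ.filter (fun z : Ea E a =>
          ∀ i : {w // w ∈ aDn}, z ⟨i, hlt.subset i.2⟩ = y i),
        Real.exp (-(H a z) + H aDn y)) =
      H aDn y + Real.log (marg (proj E hlt.subset) (fun x => Real.exp (-(H a x))) y) := by
    intro y
    obtain ⟨x, rfl⟩ := hsurj y
    have hz := (Z_pos (proj E hlt.subset) (H a) x).ne'
    rw [add_comm (H aDn _), ← Real.log_exp (H aDn (proj E hlt.subset x)), ← Real.log_mul hz (Real.exp_pos _).ne']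
    congr 1
    rw [marg, Finset.sum_mul]
    refine Finset.sum_congr ?_ fun z _ => ?_
    · ext z
      simp [proj, funext_iff]
    · rw [Real.log_exp, Real.exp_add]
  unfold Lfun
  simp only [hZ]
  unfold BT
  rw [sum_split haA]
  have : ∑ c : (A.erase a : Finset (Finset I)), (coefC A μA (c : Finset I) : ℝ) *
      ((∑ x, res a Q c x * H (c : Finset I) x) - entropy (res a Q c)) =
    ∑ c : (A.erase a : Finset (Finset I)), (coefC (A.erase a) μB (c : Finset I) : ℝ) *
      ((∑ x, res a Q c x * H (c : Finset I) x) - entropy (res a Q c)) -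
      ((∑ x, res a Q ⟨aDn, hDnB⟩ x * H aDn x) - entropy (res a Q ⟨aDn, hDnB⟩)) := by
    rw [eq_sub_iff_add_eq, ← eq_sub_iff_add_eq', ← Finset.sum_sub_distrib]
    rw [Finset.sum_eq_single (⟨aDn, hDnB⟩ : (A.erase a : Finset (Finset I)))]
    · rw [cb aDn hDnB]; push_cast; simp; ring
    · intro c _ hne
      rw [cb c c.2, if_neg (fun h => hne (Subtype.ext h))]; push_cast; ring
    · simp
  simp only [ca]
  have t : ∀ c : (A.erase a : Finset (Finset I)), Q ⟨c, Finset.mem_of_mem_erase c.2⟩ = res a Q c :=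
    fun _ => rfl
  simp only [t]
  rw [this]
  unfold kfun entropy
  simp only [mul_add, Finset.sum_add_distrib]
  push_cast
  ring

lemma proj_surj [∀ i, Nonempty (E i)] {b c : Finset I} (h : b ⊆ c) :
    Function.Surjective (proj E h) := by
  intro y
  refine ⟨fun i => if hi : (i : I) ∈ b then y ⟨i, hi⟩ else Classical.arbitrary _, ?_⟩
  funext i
  simp [proj]

lemma bt_diff (A : Finset (Finset I)) (μ : Finset I → Finset I → ℤ)
    (H : (c : Finset I) → Ea E c → ℝ) (P u : Fam E A) (hP : ∀ c x, 0 < P c x) :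
    DifferentiableAt ℝ (fun t : ℝ => BT E A μ H (fun c x => P c x + t * u c x)) 0 := by
  unfold BT entropy
  refine DifferentiableAt.fun_sum fun c _ => ?_
  refine DifferentiableAt.const_mul ?_ _
  refine DifferentiableAt.sub ?_ (DifferentiableAt.neg ?_)
  · exact DifferentiableAt.fun_sum fun x _ => (hasDeriv_lin _ _ _).differentiableAt
  · exact DifferentiableAt.fun_sum fun x _ => (hasDeriv_xlogx _ _ (hP c x)).differentiableAt

lemma lfun_diff (hsub : aDn ⊆ a) (hDnB : aDn ∈ A.erase a) (μ : Finset I → Finset I → ℤ)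
    (H : (c : Finset I) → Ea E c → ℝ) (P u : Fam E (A.erase a)) (hP : ∀ c x, 0 < P c x) :
    DifferentiableAt ℝ (fun t : ℝ => Lfun E A a aDn hsub hDnB μ H
      (fun c x => P c x + t * u c x)) 0 := by
  unfold Lfun
  refine DifferentiableAt.sub (bt_diff _ _ _ _ _ hP) ?_
  exact DifferentiableAt.fun_sum fun x _ => (hasDeriv_lin _ _ _).differentiableAt

theorem main_aux [∀ i, Nonempty (E i)]
    (hchain : ChainsShort A)
    (haA : a ∈ A) (hDnA : aDn ∈ A) (hlt : aDn ⊂ a)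
    (hcolin : ∀ b ∈ A, b ⊂ a → b ⊆ aDn)
    (hDnB : aDn ∈ A.erase a)
    (μA : Finset I → Finset I → ℤ) (hμA : IsMobius A μA)
    (μB : Finset I → Finset I → ℤ) (hμB : IsMobius (A.erase a) μB)
    (H : (c : Finset I) → Ea E c → ℝ) :
    Set.BijOn (psiMap E A a aDn hlt.subset hDnB H)
      {Q : Fam E (A.erase a) |
        IsCritical E (A.erase a) (Lfun E A a aDn hlt.subset hDnB μB H) Q}
      {Q : Fam E A | IsCritical E A (BT E A μA H) Q} ∧
    Set.BijOn (psiMap E A a aDn hlt.subset hDnB H)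
      {Q : Fam E (A.erase a) |
        IsMinimizer E (A.erase a) (Lfun E A a aDn hlt.subset hDnB μB H) Q}
      {Q : Fam E A | IsMinimizer E A (BT E A μA H) Q} := by
  have hmax : ∀ b ∈ A, a ⊆ b → b = a := by
    intro b hb h
    by_contra hne
    exact hchain aDn hDnA a haA b hb hlt (h.ssubset_of_ne (Ne.symm hne))
  have hmin : ∀ b ∈ A, b ⊂ a → b = aDn := by
    intro b hb h
    by_contra hne
    exact hchain b hb aDn hDnA a haA ((hcolin b hb h).ssubset_of_ne hne) hlt
  have hsurj : Function.Surjective (proj E hlt.subset) := proj_surj _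
  have hbt := bt_eq (E := E) hchain haA hlt hDnB hmax hmin hsurj μA hμA μB hμB H
  set F := BT E A μA H with hF
  set G := Lfun E A a aDn hlt.subset hDnB μB H with hG
  set ψ := psiMap E A a aDn hlt.subset hDnB H with hψ
  set p := proj E hlt.subset with hp
  have hres : ∀ P, res a (ψ P) = P := psi_res hlt.subset hDnB H
  have hpa : ∀ P, ψ P ⟨a, haA⟩ = lift' p (H a) (P ⟨aDn, hDnB⟩) := psi_a haA hlt.subset hDnB H
  have hinj : Function.Injective ψ := Function.LeftInverse.injective (g := res a) hres
  have hcompat : ∀ Q : Fam E A, Compat (A.erase a) (res a Q) →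
      res a Q ⟨aDn, hDnB⟩ = marg p (Q ⟨a, haA⟩) → Compat A Q :=
    compat_of haA hlt hDnB hmax hmin
  have hmarg : ∀ Q : Fam E A, Compat A Q → res a Q ⟨aDn, hDnB⟩ = marg p (Q ⟨a, haA⟩) :=
    fun Q hQ => hQ ⟨a, haA⟩ ⟨aDn, hDnA⟩ hlt.subset
  have hψL : ∀ P, MemL E (A.erase a) P → MemL E A (ψ P) := by
    intro P hP
    rw [memL_iff] at hP ⊢
    refine ⟨?_, hcompat _ (by rw [hres]; exact hP.2) (by rw [hres, hpa, marg_lift p _ hsurj])⟩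
    rintro ⟨c, hc⟩
    by_cases h : c = a
    · subst h
      rw [hpa]
      refine ⟨lift_nonneg _ _ _ (hP.1 ⟨aDn, hDnB⟩).1, ?_⟩
      rw [← marg_sum_one p, marg_lift p _ hsurj]
      exact (hP.1 ⟨aDn, hDnB⟩).2
    · have := hP.1 ⟨c, Finset.mem_erase.2 ⟨h, hc⟩⟩
      rw [← hres P] at this
      exact this
  have hψI : ∀ P, MemLInt E (A.erase a) P → MemLInt E A (ψ P) := by
    intro P hP
    refine ⟨hψL P hP.1, ?_⟩
    rintro ⟨c, hc⟩
    by_cases h : c = a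
    · subst h
      rw [hpa]
      exact lift_pos _ _ _ (hP.2 ⟨aDn, hDnB⟩)
    · have := hP.2 ⟨c, Finset.mem_erase.2 ⟨h, hc⟩⟩
      rw [← hres P] at this
      exact this
  have hresI : ∀ Q, MemLInt E A Q → MemLInt E (A.erase a) (res a Q) :=
    fun Q hQ => ⟨memL_res hQ.1, fun c => hQ.2 ⟨c, Finset.mem_of_mem_erase c.2⟩⟩
  have hTof : ∀ u : Fam E A, MemT E (A.erase a) (res a u) →
      res a u ⟨aDn, hDnB⟩ = marg p (u ⟨a, haA⟩) → MemT E A u := by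
    intro u h1 h2
    rw [memT_iff] at h1 ⊢
    refine ⟨?_, hcompat _ h1.2 h2⟩
    rintro ⟨c, hc⟩
    by_cases h : c = a
    · subst h
      rw [← marg_sum_one p, ← h2]
      exact h1.1 ⟨aDn, hDnB⟩
    · exact h1.1 ⟨c, Finset.mem_erase.2 ⟨h, hc⟩⟩
  -- derivative formula
  have hder : ∀ Q, MemLInt E A Q → ∀ u, MemT E A u →
      deriv (fun t : ℝ => F (fun c x => Q c x + t * u c x)) 0 =
      deriv (fun t : ℝ => G (fun c x => res a Q c x + t * res a u c x)) 0 +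
      ∑ x, u ⟨a, haA⟩ x * (Real.log (Q ⟨a, haA⟩ x) -
        Real.log (lift' p (H a) (res a Q ⟨aDn, hDnB⟩) x)) := by
    intro Q hQ u hu
    have m1 := hmarg Q ((memL_iff _ _).1 hQ.1).2
    have m2 := hmarg u ((memT_iff _ _).1 hu).2
    have k := kfun_deriv p (H a) (Q ⟨a, haA⟩) (u ⟨a, haA⟩) (hQ.2 ⟨a, haA⟩)
      (by rw [← m1]; exact hQ.2 ⟨aDn, hDnA⟩)
    have l := (lfun_diff hlt.subset hDnB μB H (res a Q) (res a u) (hresI Q hQ).2).hasDerivAt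
    rw [← m1, ← m2] at k
    have := (l.add k).deriv
    rw [← this]
    congr 1
    funext t
    exact hbt _
  constructor
  · refine ⟨?_, hinj.injOn, ?_⟩
    · intro P hP
      refine ⟨hψI P hP.1, fun u hu => ?_⟩
      rw [hder _ (hψI P hP.1) u hu, hres, hpa, hP.2 _ (memT_res hu)]
      simp
    · intro Q hQ
      have m1 := hmarg Q ((memL_iff _ _).1 hQ.1.1).2
      have hQe : Q = ψ (res a Q) := by
        refine fam_ext haA (hres _).symm ?_
        rw [hpa]
        obtain ⟨u, hu1, hu2⟩ := exists_glue haA (0 : Fam E (A.erase a))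
          (fun x => Q ⟨a, haA⟩ x - lift' p (H a) (res a Q ⟨aDn, hDnB⟩) x)
        have hu : MemT E A u := by
          refine hTof u ?_ ?_
          · rw [hu1]; simp [MemT]
          · rw [hu1, hu2]
            funext y
            have e1 := congrFun m1 y
            have e2 := congrFun (marg_lift p (H a) hsurj (res a Q ⟨aDn, hDnB⟩)) y
            simp only [marg, Finset.sum_sub_distrib] at e1 e2 ⊢
            rw [e2, ← e1]; simp
        have d := hder Q hQ.1 u hu
        rw [hQ.2 u hu, hu1, hu2] at d
        refine log_mono_eq _ _ (hQ.1.2 _) (lift_pos _ _ _ ((hresI Q hQ.1).2 ⟨aDn, hDnB⟩)) ?_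
        rw [d]
        simp
      refine ⟨res a Q, ⟨hresI Q hQ.1, fun v hv => ?_⟩, hQe.symm⟩
      obtain ⟨u, hu1, hu2⟩ := exists_glue haA v (lift' p (H a) (v ⟨aDn, hDnB⟩))
      have hu : MemT E A u := by
        refine hTof u (by rwa [hu1]) ?_
        rw [hu1, hu2, marg_lift p _ hsurj]
      have d := hder Q hQ.1 u hu
      have e : Q ⟨a, haA⟩ = lift' p (H a) (res a Q ⟨aDn, hDnB⟩) := by
        rw [← hpa, ← hQe]
      rw [hQ.2 u hu, hu1, ← e] at d
      simpa using d.symm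
  · have hFψ : ∀ P, MemL E (A.erase a) P → F (ψ P) = G P := by
      intro P hP
      rw [hbt, hres, hpa, kfun_lift p _ hsurj _ (hP.1 ⟨aDn, hDnB⟩).1, add_zero]
    have hge : ∀ Q, MemL E A Q → G (res a Q) ≤ F Q ∧ (F Q = G (res a Q) → Q = ψ (res a Q)) := by
      intro Q hQ
      have m1 := hmarg Q ((memL_iff _ _).1 hQ).2
      have k := kfun_nonneg p (H a) hsurj (Q ⟨a, haA⟩) (hQ.1 ⟨a, haA⟩).1
      rw [← m1] at k
      rw [hbt]
      refine ⟨by linarith [k.1], fun h => ?_⟩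
      refine fam_ext haA (hres _).symm ?_
      rw [hpa]
      exact k.2 (by linarith)
    refine ⟨?_, hinj.injOn, ?_⟩
    · intro P hP
      refine ⟨hψL P hP.1, fun Q hQ => ?_⟩
      rw [hFψ P hP.1]
      exact (hP.2 _ (memL_res hQ)).trans (hge Q hQ).1
    · intro Q hQ
      have h1 := hQ.2 _ (hψL _ (memL_res (a := a) hQ.1))
      rw [hFψ _ (memL_res hQ.1)] at h1
      have h2 := hge Q hQ.1
      refine ⟨res a Q, ⟨memL_res hQ.1, fun P hP => ?_⟩, (h2.2 (le_antisymm h1 h2.1)).symm⟩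
      have := hQ.2 _ (hψL P hP)
      rw [hFψ P hP] at this
      exact h2.1.trans this

end fam
end helpers

open Classical in
-- Let `A ⊆ P(I)` be a finite poset under inclusion whose chains have length at most 1, with
-- Hamiltonians `H_c`, let `a ∈ A` be a colinear point with witness `aDn ∈ A` (so `aDn ⊊ a`),
-- and set `B = A∖{a}`.  Then `ψ` restricts to a bijection between the critical points of `𝓛`
-- in `L(B)°` and the critical points of `BT_{A,H}` in `L(A)°`, and to a bijection between the
-- global minimizers of `𝓛` over `L(B)` and the global minimizers of `BT_{A,H}` over `L(A)`.
theorem stmt17 {I : Type} [Fintype I] [DecidableEq I]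
    (E : I → Type) [∀ i, Fintype (E i)] [∀ i, DecidableEq (E i)] [∀ i, Nonempty (E i)]
    (A : Finset (Finset I)) (hchain : ChainsShort A)
    (a aDn : Finset I) (haA : a ∈ A) (hDnA : aDn ∈ A) (hlt : aDn ⊂ a)
    (hcolin : ∀ b ∈ A, b ⊂ a → b ⊆ aDn)
    (hDnB : aDn ∈ A.erase a)
    (μA : Finset I → Finset I → ℤ) (hμA : IsMobius A μA)
    (μB : Finset I → Finset I → ℤ) (hμB : IsMobius (A.erase a) μB)
    (H : (c : Finset I) → Ea E c → ℝ) :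
    Set.BijOn (psiMap E A a aDn hlt.subset hDnB H)
      {Q : Fam E (A.erase a) |
        IsCritical E (A.erase a) (Lfun E A a aDn hlt.subset hDnB μB H) Q}
      {Q : Fam E A | IsCritical E A (BT E A μA H) Q} ∧
    Set.BijOn (psiMap E A a aDn hlt.subset hDnB H)
      {Q : Fam E (A.erase a) |
        IsMinimizer E (A.erase a) (Lfun E A a aDn hlt.subset hDnB μB H) Q}
      {Q : Fam E A | IsMinimizer E A (BT E A μA H) Q} := by
  have hI : (‹DecidableEq I› : DecidableEq I) = fun x y => Classical.propDecidable (x = y) :=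
    Subsingleton.elim _ _
  subst hI
  exact main_aux hchain haA hDnA hlt hcolin hDnB μA hμA μB hμB H
end

section
/- Let A ⊆ P(I) be a finite poset under inclusion in which every chain has length at most 1, and let H_c : E_c → ℝ (c ∈ A) be Hamiltonians. Suppose B ⊆ A is obtained from A by successively deleting points a_1, …, a_n, where for each k the point a_k is a linear or colinear point of the subposet A∖{a_1, …, a_{k−1}}. Then there exists a family of Hamiltonians H̃_c : E_c → ℝ (c ∈ B) and a bijection between the set of critical points of BT_{A,H} in L(A)° and the set of critical points of BT_{B,H̃} in L(B)°. -/
-- `x` is a linear point of the poset `A` (ordered by inclusion).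
def LinearPt {I : Type} (A : Finset (Finset I)) (x : Finset I) : Prop :=
  x ∈ A ∧ ∃ xUp ∈ A, x ⊂ xUp ∧ ∀ b ∈ A, x ⊂ b → xUp ⊆ b

-- `x` is a colinear point of the poset `A` (ordered by inclusion).
def ColinearPt {I : Type} (A : Finset (Finset I)) (x : Finset I) : Prop :=
  x ∈ A ∧ ∃ xDn ∈ A, xDn ⊂ x ∧ ∀ b ∈ A, b ⊂ x → b ⊆ xDn

-- Successive deletion of the points in the list `l` from `A`.
def eraseList {I : Type} [DecidableEq I] (A : Finset (Finset I))
    (l : List (Finset I)) : Finset (Finset I) :=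
  l.foldl Finset.erase A

open Classical in
noncomputable def s19tot {I : Type} (E : I → Type) [∀ i, Fintype (E i)] {a : Finset I}
    (f : Ea E a → ℝ) : ℝ := ∑ x, f x

open Classical in
noncomputable def s19pair {I : Type} (E : I → Type) [∀ i, Fintype (E i)] {a : Finset I}
    (f g : Ea E a → ℝ) : ℝ := ∑ x, f x * g x

open Classical in
noncomputable def s19marg {I : Type} (E : I → Type) [∀ i, Fintype (E i)] {a b : Finset I}
    (h : b ⊆ a) (f : Ea E a → ℝ) (x : Ea E b) : ℝ :=
  ∑ y ∈ Finset.univ.filter (fun y : Ea E a => proj E h y = x), f y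

open Classical in
noncomputable def s19c {I : Type} (A : Finset (Finset I)) (x : Finset I) : ℤ :=
  1 - ((A.filter (fun b => x ⊂ b)).card : ℤ)

abbrev S19F {I : Type} (E : I → Type) : Type := (c : Finset I) → Ea E c → ℝ

def S19Compat {I : Type} (E : I → Type) [∀ i, Fintype (E i)] (A : Finset (Finset I))
    (F : S19F E) : Prop :=
  ∀ a ∈ A, ∀ b ∈ A, ∀ h : b ⊆ a, F b = s19marg E h (F a)

def S19T {I : Type} (E : I → Type) [∀ i, Fintype (E i)] (A : Finset (Finset I))
    (u : S19F E) : Prop :=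
  (∀ a ∈ A, s19tot E (u a) = 0) ∧ S19Compat E A u

noncomputable def s19D {I : Type} (E : I → Type) [∀ i, Fintype (E i)] (A : Finset (Finset I))
    (H F u : S19F E) : ℝ :=
  ∑ a ∈ A, (s19c A a : ℝ) * s19pair E (u a) (fun x => H a x + Real.log (F a x))

def S19L {I : Type} (E : I → Type) [∀ i, Fintype (E i)] (A : Finset (Finset I))
    (F : S19F E) : Prop :=
  (∀ a ∈ A, ∀ x, 0 < F a x) ∧ (∀ a ∈ A, s19tot E (F a) = 1) ∧ S19Compat E A F

def S19P {I : Type} (E : I → Type) [∀ i, Fintype (E i)] (A : Finset (Finset I))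
    (H F : S19F E) : Prop :=
  S19L E A F ∧ ∀ u, S19T E A u → s19D E A H F u = 0

def S19Red {I : Type} (E : I → Type) [∀ i, Fintype (E i)] (A : Finset (Finset I))
    (H : S19F E) (B : Finset (Finset I)) (Ht : S19F E) : Prop :=
  B ⊆ A ∧ (∀ F, S19P E A H F → S19P E B Ht F) ∧
  (∀ F F', S19P E A H F → S19P E A H F' → (∀ b ∈ B, F b = F' b) → ∀ a ∈ A, F a = F' a) ∧
  (∀ F, S19P E B Ht F → ∃ F', (∀ b ∈ B, F' b = F b) ∧ S19P E A H F')

section S19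
variable {I : Type} (E : I → Type) [∀ i, Fintype (E i)]

theorem s19_tot_marg {a b : Finset I} (h : b ⊆ a) (f : Ea E a → ℝ) :
    s19tot E (s19marg E h f) = s19tot E f := by
  classical
  unfold s19tot s19marg
  exact Finset.sum_fiberwise _ _ _

theorem s19_pair_marg {a b : Finset I} (h : b ⊆ a) (f : Ea E a → ℝ) (g : Ea E b → ℝ) :
    s19pair E (s19marg E h f) g = s19pair E f (fun y => g (proj E h y)) := by
  classical
  unfold s19pair s19marg
  rw [← Finset.sum_fiberwise Finset.univ (proj E h) (fun y => f y * g (proj E h y))]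
  refine Finset.sum_congr rfl fun x _ => ?_
  rw [Finset.sum_mul]
  refine Finset.sum_congr rfl fun y hy => ?_
  rw [(Finset.mem_filter.1 hy).2]

theorem s19_marg_self {a : Finset I} (h : a ⊆ a) (f : Ea E a → ℝ) :
    s19marg E h f = f := by
  classical
  funext x
  unfold s19marg
  have : (Finset.univ.filter (fun y : Ea E a => proj E h y = x)) = {x} := by
    ext y
    simp only [Finset.mem_filter, Finset.mem_univ, true_and, Finset.mem_singleton]
    exact Iff.rfl
  rw [this, Finset.sum_singleton]

theorem s19_proj_surj [∀ i, Nonempty (E i)] {a b : Finset I} (h : b ⊆ a) (x : Ea E b) :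
    ∃ y : Ea E a, proj E h y = x := by
  classical
  refine ⟨fun i => if hi : (i : I) ∈ b then x ⟨i, hi⟩ else Classical.arbitrary _, ?_⟩
  funext i
  simp [proj]

theorem s19_marg_pos [∀ i, Nonempty (E i)] {a b : Finset I} (h : b ⊆ a) (f : Ea E a → ℝ)
    (hf : ∀ y, 0 < f y) (x : Ea E b) : 0 < s19marg E h f x := by
  classical
  obtain ⟨y, hy⟩ := s19_proj_surj E h x
  exact Finset.sum_pos (fun y _ => hf y) ⟨y, by simp [hy]⟩

theorem s19_marg_congr {a b : Finset I} (h : b ⊆ a) (f g : Ea E a → ℝ) (z : Ea E b)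
    (hfg : ∀ y, proj E h y = z → f y = g y) : s19marg E h f z = s19marg E h g z := by
  classical
  refine Finset.sum_congr rfl fun y hy => hfg y (Finset.mem_filter.1 hy).2

theorem s19_marg_mul {a b : Finset I} (h : b ⊆ a) (f : Ea E a → ℝ) (z : Ea E b) (k : ℝ) :
    s19marg E h (fun y => f y * k) z = s19marg E h f z * k := by
  classical
  unfold s19marg
  rw [Finset.sum_mul]

theorem s19_pair_add {a : Finset I} (u f g : Ea E a → ℝ) :
    s19pair E u (fun x => f x + g x) = s19pair E u f + s19pair E u g := by
  classical
  unfold s19pair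
  rw [← Finset.sum_add_distrib]
  exact Finset.sum_congr rfl fun x _ => by ring

-- The lift of a function on `E_b` to `E_a`, conditionally Gibbs.
noncomputable def s19lift {a b : Finset I} (h : b ⊆ a) (H : Ea E a → ℝ) (f : Ea E b → ℝ)
    (y : Ea E a) : ℝ :=
  Real.exp (-H y) * (f (proj E h y) / s19marg E h (fun y => Real.exp (-H y)) (proj E h y))

theorem s19_marg_lift [∀ i, Nonempty (E i)] {a b : Finset I} (h : b ⊆ a) (H : Ea E a → ℝ)
    (f : Ea E b → ℝ) : s19marg E h (s19lift E h H f) = f := by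
  funext z
  have hp := s19_marg_pos E h (fun y => Real.exp (-H y)) (fun y => Real.exp_pos _) z
  rw [s19_marg_congr E h (s19lift E h H f)
    (fun y => Real.exp (-H y) * (f z / s19marg E h (fun y => Real.exp (-H y)) z)) z
    (fun y hy => by simp only [s19lift, hy]), s19_marg_mul]
  field_simp

theorem s19_D_congr (A : Finset (Finset I)) (H F F' u u' : S19F E)
    (hF : ∀ a ∈ A, F a = F' a) (hu : ∀ a ∈ A, u a = u' a) :
    s19D E A H F u = s19D E A H F' u' := by
  unfold s19D
  exact Finset.sum_congr rfl fun a ha => by rw [hF a ha, hu a ha]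

theorem s19_compat_mono {A B : Finset (Finset I)} (hBA : B ⊆ A) {F : S19F E}
    (h : S19Compat E A F) : S19Compat E B F :=
  fun a ha b hb hba => h a (hBA ha) b (hBA hb) hba

theorem s19_compat_congr {A : Finset (Finset I)} {F F' : S19F E} (hF : ∀ a ∈ A, F a = F' a)
    (h : S19Compat E A F) : S19Compat E A F' :=
  fun a ha b hb hba => by rw [← hF a ha, ← hF b hb]; exact h a ha b hb hba

theorem s19_P_congr {A : Finset (Finset I)} {H F F' : S19F E} (hF : ∀ a ∈ A, F a = F' a)
    (h : S19P E A H F) : S19P E A H F' := by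
  refine ⟨⟨fun a ha => ?_, fun a ha => ?_, s19_compat_congr E hF h.1.2.2⟩, fun u hu => ?_⟩
  · rw [← hF a ha]; exact h.1.1 a ha
  · rw [← hF a ha]; exact h.1.2.1 a ha
  · rw [← s19_D_congr E A H F F' u u hF (fun _ _ => rfl)]; exact h.2 u hu

theorem s19_red_refl (A : Finset (Finset I)) (H : S19F E) : S19Red E A H A H :=
  ⟨Finset.Subset.refl _, fun _ h => h, fun _ _ _ _ h => h, fun F h => ⟨F, fun _ _ => rfl, h⟩⟩

theorem s19_red_trans {A B C : Finset (Finset I)} {H H' H'' : S19F E}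
    (h1 : S19Red E A H B H') (h2 : S19Red E B H' C H'') : S19Red E A H C H'' := by
  refine ⟨h2.1.trans h1.1, fun F hF => h2.2.1 F (h1.2.1 F hF), fun F F' hF hF' h => ?_,
    fun F hF => ?_⟩
  · exact h1.2.2.1 F F' hF hF' (h2.2.2.1 F F' (h1.2.1 F hF) (h1.2.1 F' hF') h)
  · obtain ⟨F1, e1, p1⟩ := h2.2.2.2 F hF
    obtain ⟨F2, e2, p2⟩ := h1.2.2.2 F1 p1
    exact ⟨F2, fun b hb => (e2 b (h2.1 hb)).trans (e1 b hb), p2⟩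

-- Generic reduction step: deleting `x`, where the value at `x` of a critical family is
-- determined by `r`, and tangent vectors extend by `ru`.
theorem s19_red_of {A B : Finset (Finset I)} {x : Finset I} (hx : x ∈ A)
    (hB : ∀ a, a ∈ B ↔ a ≠ x ∧ a ∈ A) (H Ht : S19F E)
    (r : S19F E → Ea E x → ℝ)
    (hr : ∀ F F', (∀ b ∈ B, F b = F' b) → r F = r F')
    (hext : ∀ F, S19Compat E B F → S19Compat E A (by classical exact Function.update F x (r F)))
    (htot : ∀ F, S19Compat E B F → ∀ s : ℝ, (∀ b ∈ B, s19tot E (F b) = s) → s19tot E (r F) = s)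
    (hpos : ∀ F, S19L E B F → ∀ y, 0 < r F y)
    (hdet : ∀ F, S19P E A H F → F x = r F)
    (hD : ∀ F u, S19L E A F → F x = r F → S19T E A u → s19D E A H F u = s19D E B Ht F u) :
    S19Red E A H B Ht := by
  classical
  have hBA : B ⊆ A := fun a ha => ((hB a).1 ha).2
  have hAB : ∀ a ∈ A, a = x ∨ a ∈ B := fun a ha => by
    by_cases h : a = x
    · exact Or.inl h
    · exact Or.inr ((hB a).2 ⟨h, ha⟩)
  have hxB : x ∉ B := fun h => ((hB x).1 h).1 rfl
  have hup : ∀ (F : S19F E) f, ∀ b ∈ B, Function.update F x f b = F b := fun F f b hb => by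
    rw [Function.update_of_ne]; rintro rfl; exact hxB hb
  have hext' : ∀ F, S19Compat E B F → S19Compat E A (Function.update F x (r F)) := fun F hF => by
    have := hext F hF
    convert this
  have hText : ∀ u, S19T E B u → S19T E A (Function.update u x (r u)) := fun u hu => by
    refine ⟨fun a ha => ?_, hext' u hu.2⟩
    rcases hAB a ha with rfl | h
    · rw [Function.update_self]; exact htot u hu.2 0 hu.1
    · rw [hup _ _ _ h]; exact hu.1 a h
  have hLres : ∀ F, S19L E A F → S19L E B F := fun F hF =>
    ⟨fun a ha => hF.1 a (hBA ha), fun a ha => hF.2.1 a (hBA ha), s19_compat_mono E hBA hF.2.2⟩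
  have hTres : ∀ F, S19T E A F → S19T E B F := fun F hF =>
    ⟨fun a ha => hF.1 a (hBA ha), s19_compat_mono E hBA hF.2⟩
  refine ⟨hBA, fun F hF => ⟨hLres F hF.1, fun u hu => ?_⟩, fun F F' hF hF' h a ha => ?_,
    fun F hF => ⟨Function.update F x (r F), hup _ _, ?_, fun u hu => ?_⟩⟩
  · rw [← s19_D_congr E B Ht F F _ u (fun _ _ => rfl) (hup u (r u)),
      ← hD F _ hF.1 (hdet F hF) (hText u hu)]
    exact hF.2 _ (hText u hu)
  · rcases hAB a ha with rfl | h'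
    · rw [hdet F hF, hdet F' hF']; exact hr F F' h
    · exact h a h'
  · refine ⟨fun a ha => ?_, fun a ha => ?_, hext' F hF.1.2.2⟩
    · rcases hAB a ha with rfl | h
      · rw [Function.update_self]; exact hpos F hF.1
      · rw [hup _ _ _ h]; exact hF.1.1 a h
    · rcases hAB a ha with rfl | h
      · rw [Function.update_self]; exact htot F hF.1.2.2 1 hF.1.2.1
      · rw [hup _ _ _ h]; exact hF.1.2.1 a h
  · have hL : S19L E A (Function.update F x (r F)) := by
      refine ⟨fun a ha => ?_, fun a ha => ?_, hext' F hF.1.2.2⟩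
      · rcases hAB a ha with rfl | h
        · rw [Function.update_self]; exact hpos F hF.1
        · rw [hup _ _ _ h]; exact hF.1.1 a h
      · rcases hAB a ha with rfl | h
        · rw [Function.update_self]; exact htot F hF.1.2.2 1 hF.1.2.1
        · rw [hup _ _ _ h]; exact hF.1.2.1 a h
    rw [hD _ u hL _ hu]
    · rw [s19_D_congr E B Ht _ F u u (hup _ _) (fun _ _ => rfl)]
      exact hF.2 u (hTres u hu)
    · rw [Function.update_self]
      exact hr _ _ (fun b hb => (hup F _ b hb).symm)

theorem s19_sum_split {A B : Finset (Finset I)} {x : Finset I} (hx : x ∈ A)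
    (hB : ∀ a, a ∈ B ↔ a ≠ x ∧ a ∈ A) (f : Finset I → ℝ) :
    ∑ a ∈ A, f a = f x + ∑ a ∈ B, f a := by
  classical
  have : B = A.erase x := by ext a; rw [hB, Finset.mem_erase]
  rw [this, Finset.add_sum_erase A f hx]

theorem s19_c_eq {A B : Finset (Finset I)} {x : Finset I}
    (hB : ∀ a, a ∈ B ↔ a ≠ x ∧ a ∈ A) (a : Finset I) (ha : ¬ a ⊂ x) :
    s19c B a = s19c A a := by
  classical
  unfold s19c
  have : B.filter (fun b => a ⊂ b) = A.filter (fun b => a ⊂ b) := by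
    ext b
    simp only [Finset.mem_filter, hB]
    constructor
    · rintro ⟨⟨_, h⟩, h'⟩; exact ⟨h, h'⟩
    · rintro ⟨h, h'⟩; exact ⟨⟨by rintro rfl; exact ha h', h⟩, h'⟩
  rw [this]

theorem s19_c_succ {A B : Finset (Finset I)} {x : Finset I} (hx : x ∈ A)
    (hB : ∀ a, a ∈ B ↔ a ≠ x ∧ a ∈ A) (a : Finset I) (ha : a ⊂ x) :
    s19c B a = s19c A a + 1 := by
  classical
  unfold s19c
  have : A.filter (fun b => a ⊂ b) = insert x (B.filter (fun b => a ⊂ b)) := by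
    ext b
    simp only [Finset.mem_filter, hB, Finset.mem_insert]
    constructor
    · rintro ⟨h, h'⟩
      by_cases hb : b = x
      · exact Or.inl hb
      · exact Or.inr ⟨⟨hb, h⟩, h'⟩
    · rintro (rfl | ⟨⟨_, h⟩, h'⟩)
      · exact ⟨hx, ha⟩
      · exact ⟨h, h'⟩
  rw [this, Finset.card_insert_of_notMem (by simp [hB])]
  push_cast
  ring

theorem s19_c_max {A : Finset (Finset I)} {x : Finset I} (h : ∀ b ∈ A, ¬ x ⊂ b) :
    s19c A x = 1 := by
  classical
  unfold s19c
  rw [Finset.filter_eq_empty_iff.2 (fun {b} hb => h b hb)]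
  simp

theorem s19_linear [∀ i, Nonempty (E i)] {A B : Finset (Finset I)} (hch : ChainsShort A)
    {x : Finset I} (hB : ∀ a, a ∈ B ↔ a ≠ x ∧ a ∈ A) (hl : LinearPt A x) (H : S19F E) :
    S19Red E A H B H := by
  classical
  obtain ⟨hx, p, hp, hxp, hmin⟩ := hl
  have hpB : p ∈ B := (hB p).2 ⟨hxp.ne', hp⟩
  have hbelow : ∀ b ∈ A, ¬ b ⊂ x := fun b hb h => hch b hb x hx p hp h hxp
  have habove : ∀ b ∈ A, x ⊂ b → b = p := fun b hb h => by
    by_contra hne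
    exact hch x hx p hp b hb hxp (lt_of_le_of_ne (hmin b hb h) (Ne.symm hne))
  refine s19_red_of E hx hB H H (fun F => s19marg E hxp.subset (F p)) ?_ ?_ ?_ ?_ ?_ ?_
  · intro F F' h
    simp only [h p hpB]
  · intro F hF a ha b hb hba
    by_cases h1 : a = x
    · subst h1
      by_cases h2 : b = a
      · subst h2; rw [s19_marg_self]
      · exact absurd (lt_of_le_of_ne hba h2) (hbelow b hb)
    · rw [Function.update_of_ne h1]
      by_cases h2 : b = x
      · subst h2
        obtain rfl := habove a ha (lt_of_le_of_ne hba (Ne.symm h1))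
        rw [Function.update_self]
      · rw [Function.update_of_ne h2]
        exact hF a ((hB a).2 ⟨h1, ha⟩) b ((hB b).2 ⟨h2, hb⟩) hba
  · intro F hF s hs
    simp only [s19_tot_marg]
    exact hs p hpB
  · intro F hF y
    exact s19_marg_pos E _ _ (hF.1 p hpB) y
  · intro F hF
    exact hF.1.2.2 p hp x hx _
  · intro F u hF hFx hu
    unfold s19D
    rw [s19_sum_split hx hB]
    have hc : s19c A x = 0 := by
      unfold s19c
      have : A.filter (fun b => x ⊂ b) = {p} := by
        ext b
        simp only [Finset.mem_filter, Finset.mem_singleton]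
        constructor
        · rintro ⟨h, h'⟩; exact habove b h h'
        · rintro rfl; exact ⟨hp, hxp⟩
      rw [this]; simp
    rw [hc, Int.cast_zero, zero_mul, zero_add]
    refine Finset.sum_congr rfl fun a ha => ?_
    rw [s19_c_eq hB a (hbelow a ((hB a).1 ha).2)]

theorem s19_det [∀ i, Nonempty (E i)] {a b : Finset I} (h : b ⊆ a) (H f : Ea E a → ℝ)
    (g : Ea E b → ℝ) (hf : ∀ y, 0 < f y) (hg : g = s19marg E h f)
    (hc : ∀ v : Ea E a → ℝ, s19marg E h v = 0 →
      s19pair E v (fun y => H y + Real.log (f y)) = 0) :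
    f = s19lift E h H g := by
  classical
  have key : ∀ y y', proj E h y' = proj E h y →
      H y' + Real.log (f y') = H y + Real.log (f y) := by
    intro y y' hyy
    have := hc (fun z => (if z = y' then 1 else 0) - (if z = y then 1 else 0)) ?_
    · unfold s19pair at this
      simp only [sub_mul, ite_mul, one_mul, zero_mul, Finset.sum_sub_distrib] at this
      rw [Finset.sum_ite_eq' Finset.univ y', Finset.sum_ite_eq' Finset.univ y] at this
      simp only [Finset.mem_univ, if_true] at this
      linarith
    · funext z
      unfold s19marg
      rw [Finset.sum_sub_distrib, Finset.sum_ite_eq', Finset.sum_ite_eq']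
      simp [hyy]
  funext y
  have hp := s19_marg_pos E h (fun y => Real.exp (-H y)) (fun y => Real.exp_pos _) (proj E h y)
  unfold s19lift
  rw [hg, s19_marg_congr E h f (fun y' => Real.exp (-H y') * (f y * Real.exp (H y))) (proj E h y),
    s19_marg_mul]
  · rw [mul_div_cancel_left₀ _ hp.ne', mul_comm (f y), ← mul_assoc, ← Real.exp_add]
    simp
  · intro y' hy'
    have := key y y' hy'
    rw [← Real.exp_log (hf y'), ← Real.exp_log (hf y), ← Real.exp_add, ← Real.exp_add]
    congr 1
    linarith

theorem s19_pair_lift [∀ i, Nonempty (E i)] {a b : Finset I} (h : b ⊆ a) (H f v : Ea E a → ℝ)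
    (g : Ea E b → ℝ) (hg : ∀ z, 0 < g z) (hf : f = s19lift E h H g) :
    s19pair E v (fun y => H y + Real.log (f y)) =
      s19pair E (s19marg E h v)
        (fun z => Real.log (g z) - Real.log (s19marg E h (fun y => Real.exp (-H y)) z)) := by
  rw [s19_pair_marg]
  congr 1
  funext y
  have hp := s19_marg_pos E h (fun y => Real.exp (-H y)) (fun y => Real.exp_pos _) (proj E h y)
  rw [hf]
  unfold s19lift
  rw [Real.log_mul (Real.exp_pos _).ne' (div_pos (hg _) hp).ne', Real.log_exp,
    Real.log_div (hg _).ne' hp.ne']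
  ring

theorem s19_colinear [∀ i, Nonempty (E i)] {A B : Finset (Finset I)} (hch : ChainsShort A)
    {x : Finset I} (hB : ∀ a, a ∈ B ↔ a ≠ x ∧ a ∈ A) (hl : ColinearPt A x) (H : S19F E) :
    ∃ Ht, S19Red E A H B Ht := by
  classical
  obtain ⟨hx, d, hd, hdx, hmax⟩ := hl
  have hdB : d ∈ B := (hB d).2 ⟨hdx.ne, hd⟩
  have habove : ∀ b ∈ A, ¬ x ⊂ b := fun b hb h => hch d hd x hx b hb hdx h
  have hbelow : ∀ b ∈ A, b ⊂ x → b = d := fun b hb h => by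
    by_contra hne
    exact hch b hb d hd x hx (lt_of_le_of_ne (hmax b hb h) hne) hdx
  have hcx : s19c A x = 1 := s19_c_max habove
  obtain ⟨m, hmB, hdm, hcm⟩ : ∃ m ∈ B, d ⊆ m ∧ s19c B m = 1 := by
    by_cases h : ∃ b ∈ B, d ⊂ b
    · obtain ⟨b, hb, hdb⟩ := h
      exact ⟨b, hb, hdb.subset, s19_c_max fun c hc hbc =>
        hch d hd b ((hB b).1 hb).2 c ((hB c).1 hc).2 hdb hbc⟩
    · push Not at h
      exact ⟨d, hdB, subset_rfl, s19_c_max h⟩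
  set Z : Ea E d → ℝ := s19marg E hdx.subset (fun y => Real.exp (-H x y)) with hZ
  set w : Ea E d → ℝ := fun z => -H d z - Real.log (Z z) with hw
  have hext : ∀ (F : S19F E) (f : Ea E x → ℝ), s19marg E hdx.subset f = F d →
      S19Compat E B F → S19Compat E A (Function.update F x f) := by
    intro F f hf hF a ha b hb hba
    by_cases h1 : a = x
    · subst h1
      by_cases h2 : b = a
      · subst h2; rw [s19_marg_self]
      · obtain rfl := hbelow b hb (lt_of_le_of_ne hba h2)
        rw [Function.update_of_ne h2, Function.update_self]
        exact hf.symm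
    · rw [Function.update_of_ne h1]
      by_cases h2 : b = x
      · subst h2
        exact absurd (lt_of_le_of_ne hba (Ne.symm h1)) (habove a ha)
      · rw [Function.update_of_ne h2]
        exact hF a ((hB a).2 ⟨h1, ha⟩) b ((hB b).2 ⟨h2, hb⟩) hba
  refine ⟨Function.update H m (fun y => H m y + w (proj E hdm y)), ?_⟩
  refine s19_red_of E hx hB H _ (fun F => s19lift E hdx.subset (H x) (F d)) ?_ ?_ ?_ ?_ ?_ ?_
  · intro F F' h
    simp only [h d hdB]
  · intro F hF
    exact hext F _ (s19_marg_lift E _ _ _) hF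
  · intro F hF s hs
    rw [← s19_tot_marg E hdx.subset]
    simp only [s19_marg_lift]
    exact hs d hdB
  · intro F hF y
    exact mul_pos (Real.exp_pos _) (div_pos (hF.1 d hdB _)
      (s19_marg_pos E _ _ (fun y => Real.exp_pos _) _))
  · intro F hF
    refine s19_det E _ (H x) (F x) (F d) (hF.1.1 x hx) (hF.1.2.2 x hx d hd _) ?_
    intro v hv
    have hz : ∀ {a b : Finset I} (h : b ⊆ a), s19marg E h (0 : Ea E a → ℝ) = 0 := by
      intro a b h
      funext z
      simp [s19marg]
    have hT : S19T E A (Function.update (0 : S19F E) x v) := by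
      refine ⟨fun a ha => ?_, hext 0 v hv ?_⟩
      · by_cases h : a = x
        · subst h
          rw [Function.update_self, ← s19_tot_marg E hdx.subset, hv]
          simp [s19tot]
        · rw [Function.update_of_ne h]; simp [s19tot]
      · intro a _ b _ h
        exact (hz h).symm
    have := hF.2 _ hT
    unfold s19D at this
    rw [s19_sum_split hx hB, Finset.sum_eq_zero, hcx, Function.update_self] at this
    · simpa using this
    · intro a ha
      rw [Function.update_of_ne ((hB a).1 ha).1]
      simp [s19pair]
  · intro F u hF hFx hu
    have hud : s19marg E hdx.subset (u x) = u d := (hu.2 x hx d hd _).symm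
    have e1 : s19D E A H F u = s19pair E (u d) (fun z => Real.log (F d z) - Real.log (Z z)) +
        ∑ a ∈ B, (s19c A a : ℝ) * s19pair E (u a) (fun x => H a x + Real.log (F a x)) := by
      unfold s19D
      rw [s19_sum_split hx hB, hcx,
        s19_pair_lift E hdx.subset (H x) (F x) (u x) (F d) (hF.1 d hd) hFx, hud]
      simp [hZ]
    have e2 : s19D E B (Function.update H m (fun y => H m y + w (proj E hdm y))) F u =
        s19pair E (u d) w +
        ∑ a ∈ B, (s19c B a : ℝ) * s19pair E (u a) (fun x => H a x + Real.log (F a x)) := by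
      unfold s19D
      rw [← Finset.add_sum_erase B _ hmB, ← Finset.add_sum_erase B
        (fun a => (s19c B a : ℝ) * s19pair E (u a) (fun x => H a x + Real.log (F a x))) hmB]
      rw [← add_assoc]
      congr 1
      · rw [hcm, Function.update_self, hu.2 m ((hB m).1 hmB).2 d hd hdm, s19_pair_marg]
        simp only [Int.cast_one, one_mul]
        rw [← s19_pair_add]
        congr 1
        funext y
        ring
      · refine Finset.sum_congr rfl fun a ha => ?_
        rw [Function.update_of_ne (Finset.mem_erase.1 ha).1]
    have e3 : ∑ a ∈ B, (s19c B a : ℝ) * s19pair E (u a) (fun x => H a x + Real.log (F a x)) =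
        s19pair E (u d) (fun x => H d x + Real.log (F d x)) +
        ∑ a ∈ B, (s19c A a : ℝ) * s19pair E (u a) (fun x => H a x + Real.log (F a x)) := by
      rw [← Finset.add_sum_erase B _ hdB, ← Finset.add_sum_erase B
        (fun a => (s19c A a : ℝ) * s19pair E (u a) (fun x => H a x + Real.log (F a x))) hdB]
      rw [← add_assoc]
      congr 1
      · rw [s19_c_succ hx hB d hdx]
        push_cast
        ring
      · refine Finset.sum_congr rfl fun a ha => ?_
        rw [s19_c_eq hB a]
        intro h
        exact (Finset.mem_erase.1 ha).1
          (hbelow a ((hB a).1 (Finset.mem_erase.1 ha).2).2 h)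
    rw [e1, e2, e3, ← add_assoc, ← s19_pair_add]
    congr 2
    funext z
    simp only [hw]
    ring

theorem s19_coef {A : Finset (Finset I)} (hch : ChainsShort A) {μ : Finset I → Finset I → ℤ}
    (hμ : IsMobius A μ) {x : Finset I} (hx : x ∈ A) : coefC A μ x = s19c A x := by
  classical
  have h1 : μ x x = 1 := by
    have := hμ.2 x hx x hx subset_rfl
    rw [if_pos rfl] at this
    rw [← this]
    rw [Finset.sum_eq_single x]
    · intro b hb hne
      simp only [Finset.mem_filter] at hb
      exact absurd (Finset.Subset.antisymm hb.2.2 hb.2.1) hne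
    · intro h
      simp [hx] at h
  have h2 : ∀ b ∈ A, x ⊂ b → μ b x = -1 := by
    intro b hb hxb
    have := hμ.2 b hb x hx hxb.subset
    rw [if_neg hxb.ne'] at this
    have hf : A.filter (fun c => x ⊆ c ∧ c ⊆ b) = {x, b} := by
      ext c
      simp only [Finset.mem_filter, Finset.mem_insert, Finset.mem_singleton]
      constructor
      · rintro ⟨hc, h, h'⟩
        by_contra hcon
        push Not at hcon
        exact hch x hx c hc b hb (lt_of_le_of_ne h (Ne.symm hcon.1)) (lt_of_le_of_ne h' hcon.2)
      · rintro (rfl | rfl)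
        · exact ⟨hx, subset_rfl, hxb.subset⟩
        · exact ⟨hb, hxb.subset, subset_rfl⟩
    have h3 : ∑ c ∈ A.filter (fun c => x ⊆ c ∧ c ⊆ b), μ c x = μ x x + μ b x := by
      rw [hf, Finset.sum_pair hxb.ne]
    have h4 : μ x x + μ b x = 0 := by
      rw [← h3]; convert this
    linarith
  have hf : A.filter (fun b => x ⊆ b) = insert x (A.filter (fun b => x ⊂ b)) := by
    ext c
    simp only [Finset.mem_filter, Finset.mem_insert]
    constructor
    · rintro ⟨hc, h⟩
      by_cases hcx : c = x
      · exact Or.inl hcx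
      · exact Or.inr ⟨hc, lt_of_le_of_ne h (Ne.symm hcx)⟩
    · rintro (rfl | ⟨h, h'⟩)
      · exact ⟨hx, subset_rfl⟩
      · exact ⟨h, h'.subset⟩
  have h5 : coefC A μ x = ∑ b ∈ A.filter (fun b => x ⊆ b), μ b x := by
    unfold coefC; congr
  have h6 : s19c A x = 1 - ((A.filter (fun b => x ⊂ b)).card : ℤ) := by
    unfold s19c; congr
  rw [h5, h6, hf, Finset.sum_insert (by simp), h1,
    Finset.sum_congr rfl (g := fun _ => (-1 : ℤ)) (fun b hb => by
      rw [Finset.mem_filter] at hb; exact h2 b hb.1 hb.2)]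
  simp
  ring

theorem s19_deriv {A : Finset (Finset I)} (hch : ChainsShort A) {μ : Finset I → Finset I → ℤ}
    (hμ : IsMobius A μ) (H F u : S19F E) (hF : ∀ a ∈ A, ∀ x, 0 < F a x)
    (hu : ∀ a ∈ A, s19tot E (u a) = 0) :
    deriv (fun t : ℝ => BT E A μ H (fun a x => F a x + t * u a x)) 0 = s19D E A H F u := by
  classical
  have hs : s19D E A H F u = ∑ a : A, (coefC A μ (a : Finset I) : ℝ) *
      ((∑ x, u a x * H a x) - (-∑ x, (Real.log (F a x) + 1) * u a x)) := by
    unfold s19D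
    rw [← Finset.sum_coe_sort A]
    refine Finset.sum_congr rfl fun a _ => ?_
    rw [s19_coef hch hμ a.2]
    congr 1
    have h0 := hu a a.2
    unfold s19tot at h0
    unfold s19pair
    have h0' : ∑ x, u a x = 0 := by convert h0
    have : ∑ x, (Real.log (F a x) + 1) * u a x = ∑ x, Real.log (F a x) * u a x + ∑ x, u a x := by
      rw [← Finset.sum_add_distrib]
      exact Finset.sum_congr rfl fun x _ => by ring
    rw [this, h0', sub_neg_eq_add, add_zero, ← Finset.sum_add_distrib]
    convert Finset.sum_congr rfl fun x _ => ?_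
    ring
  rw [hs]
  apply HasDerivAt.deriv
  unfold BT entropy
  have hl : ∀ p q : ℝ, HasDerivAt (fun t : ℝ => p + t * q) q 0 := fun p q => by
    simpa using ((hasDerivAt_id (0 : ℝ)).mul_const q).const_add p
  have key : ∀ a : A, HasDerivAt (fun t : ℝ => (coefC A μ (a : Finset I) : ℝ) *
      ((∑ x, (F a x + t * u a x) * H a x) -
        (-∑ x, (F a x + t * u a x) * Real.log (F a x + t * u a x))))
      ((coefC A μ (a : Finset I) : ℝ) *
      ((∑ x, u a x * H a x) - (-∑ x, (Real.log (F a x) + 1) * u a x))) 0 := by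
    intro a
    refine HasDerivAt.const_mul _ (HasDerivAt.sub ?_ (HasDerivAt.neg ?_))
    · exact HasDerivAt.fun_sum fun x _ => (hl _ _).mul_const _
    · refine HasDerivAt.fun_sum fun x _ => ?_
      have hne : F a x + 0 * u a x ≠ 0 := by
        have := hF a a.2 x
        simp [this.ne']
      have := (Real.hasDerivAt_mul_log hne).comp (0 : ℝ) (hl (F a x) (u a x))
      simpa [Function.comp_def] using this
  have := HasDerivAt.fun_sum (u := Finset.univ) fun a _ => key a
  convert this

noncomputable def s19ext {A : Finset (Finset I)} (Q : Fam E A) : S19F E := by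
  classical exact fun c => if h : c ∈ A then Q ⟨c, h⟩ else 0

theorem s19_ext_apply {A : Finset (Finset I)} (Q : Fam E A) (a : A) :
    s19ext E Q a = Q a := by
  simp [s19ext]

theorem s19_crit {A : Finset (Finset I)} (hch : ChainsShort A) {μ : Finset I → Finset I → ℤ}
    (hμ : IsMobius A μ) (H F : S19F E) :
    IsCritical E A (BT E A μ H) (fun a => F a) ↔ S19P E A H F := by
  have hC : ∀ F : S19F E, (∀ (a b : A) (h : (b : Finset I) ⊆ (a : Finset I)) (x),
      F b x = s19marg E h (F a) x) ↔ S19Compat E A F := fun F =>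
    ⟨fun h a ha b hb hba => funext fun x => h ⟨a, ha⟩ ⟨b, hb⟩ hba x,
     fun h a b hba x => congrFun (h a a.2 b b.2 hba) x⟩
  have hLiff : MemLInt E A (fun a => F a) ↔ S19L E A F := by
    constructor
    · rintro ⟨⟨h1, h2⟩, h3⟩
      exact ⟨fun a ha => h3 ⟨a, ha⟩, fun a ha => (h1 ⟨a, ha⟩).2, (hC F).1 h2⟩
    · rintro ⟨h1, h2, h3⟩
      exact ⟨⟨fun a => ⟨fun x => (h1 a a.2 x).le, h2 a a.2⟩, (hC F).2 h3⟩, fun a => h1 a a.2⟩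
  have hTiff : ∀ u : S19F E, MemT E A (fun a => u a) ↔ S19T E A u := fun u =>
    ⟨fun h => ⟨fun a ha => h.1 ⟨a, ha⟩, (hC u).1 h.2⟩,
     fun h => ⟨fun a => h.1 a a.2, (hC u).2 h.2⟩⟩
  unfold IsCritical S19P
  rw [hLiff]
  refine and_congr_right fun hL => ⟨fun h u hu => ?_, fun h u hu => ?_⟩
  · rw [← s19_deriv E hch hμ H F u hL.1 hu.1]
    exact h (fun a => u a) ((hTiff u).2 hu)
  · have hue : u = fun a : A => s19ext E u a := funext fun a => (s19_ext_apply E u a).symm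
    rw [hue] at hu ⊢
    have hu' := (hTiff _).1 hu
    rw [s19_deriv E hch hμ H F _ hL.1 hu'.1]
    exact h _ hu'

theorem s19_final {A B : Finset (Finset I)} (hA : ChainsShort A) (hB : ChainsShort B)
    {μA μB : Finset I → Finset I → ℤ} (hμA : IsMobius A μA) (hμB : IsMobius B μB)
    (H Ht : S19F E) (hR : S19Red E A H B Ht) :
    ∃ g : Fam E A → Fam E B, Set.BijOn g
        {Q : Fam E A | IsCritical E A (BT E A μA H) Q}
        {Q : Fam E B | IsCritical E B (BT E B μB Ht) Q} := by
  have hue : ∀ {A : Finset (Finset I)} (u : Fam E A), u = fun a : A => s19ext E u a :=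
    fun u => funext fun a => (s19_ext_apply E u a).symm
  have iA : ∀ Q : Fam E A, IsCritical E A (BT E A μA H) Q ↔ S19P E A H (s19ext E Q) := fun Q => by
    conv_lhs => rw [hue Q]
    exact s19_crit E hA hμA H _
  have iB : ∀ Q : Fam E B, IsCritical E B (BT E B μB Ht) Q ↔ S19P E B Ht (s19ext E Q) :=
    fun Q => by
    conv_lhs => rw [hue Q]
    exact s19_crit E hB hμB Ht _
  refine ⟨fun Q b => s19ext E Q b, fun Q hQ => ?_, fun Q hQ Q' hQ' h => ?_, fun Q hQ => ?_⟩
  · have := hR.2.1 _ ((iA Q).1 hQ)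
    exact (s19_crit E hB hμB Ht _).2 this
  · have := hR.2.2.1 _ _ ((iA Q).1 hQ) ((iA Q').1 hQ') (fun b hb => congrFun h ⟨b, hb⟩)
    funext a
    rw [← s19_ext_apply E Q, ← s19_ext_apply E Q']
    exact this a a.2
  · obtain ⟨F, h1, h2⟩ := hR.2.2.2 _ ((iB Q).1 hQ)
    refine ⟨fun a => F a, (s19_crit E hA hμA H F).2 h2, ?_⟩
    funext b
    have e := s19_ext_apply E (fun a : A => F a) ⟨b, hR.1 b.2⟩
    change s19ext E (fun a : A => F a) (b : Finset I) = F b at e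
    change s19ext E (fun a : A => F a) (b : Finset I) = Q b
    rw [e, h1 b b.2, s19_ext_apply]

theorem s19_list [DecidableEq I] [∀ i, Nonempty (E i)] (as : List (Finset I)) :
    ∀ (A : Finset (Finset I)) (_ : ChainsShort A)
      (_ : ∀ (k : ℕ) (hk : k < as.length),
        LinearPt (eraseList A (as.take k)) (as.get ⟨k, hk⟩) ∨
        ColinearPt (eraseList A (as.take k)) (as.get ⟨k, hk⟩))
      (H : S19F E), ∃ Ht, S19Red E A H (eraseList A as) Ht := by
  induction as with
  | nil => intro A _ _ H; exact ⟨H, s19_red_refl E A H⟩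
  | cons x l ih =>
    intro A hch hs H
    have hB : ∀ a, a ∈ A.erase x ↔ a ≠ x ∧ a ∈ A := fun a => Finset.mem_erase
    have h1 : ∃ H1, S19Red E A H (A.erase x) H1 := by
      rcases hs 0 (by simp) with h | h
      · exact ⟨H, s19_linear E hch hB h H⟩
      · exact s19_colinear E hch hB h H
    obtain ⟨H1, h1⟩ := h1
    have hch' : ChainsShort (A.erase x) := fun a ha b hb c hc =>
      hch a (h1.1 ha) b (h1.1 hb) c (h1.1 hc)
    obtain ⟨H2, h2⟩ := ih (A.erase x) hch' (fun k hk => by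
      have := hs (k + 1) (by simpa using hk)
      simpa [eraseList] using this) H1
    exact ⟨H2, s19_red_trans E h1 h2⟩

end S19

open Classical in
-- Let `A ⊆ P(I)` be a finite poset under inclusion whose chains have length at most 1, with
-- Hamiltonians `H_c`.  Suppose `B` is obtained from `A` by successively deleting points
-- `a_1, …, a_n`, where each `a_k` is a linear or colinear point of `A∖{a_1, …, a_{k−1}}`.
-- Then there are Hamiltonians `H̃_c` (`c ∈ B`) and a bijection between the critical points of
-- `BT_{A,H}` in `L(A)°` and the critical points of `BT_{B,H̃}` in `L(B)°`.
theorem stmt19 {I : Type} [Fintype I] [DecidableEq I]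
    (E : I → Type) [∀ i, Fintype (E i)] [∀ i, DecidableEq (E i)] [∀ i, Nonempty (E i)]
    (A : Finset (Finset I)) (hchain : ChainsShort A)
    (as : List (Finset I))
    (hsteps : ∀ (k : ℕ) (hk : k < as.length),
      LinearPt (eraseList A (as.take k)) (as.get ⟨k, hk⟩) ∨
      ColinearPt (eraseList A (as.take k)) (as.get ⟨k, hk⟩))
    (B : Finset (Finset I)) (hB : B = eraseList A as)
    (μA : Finset I → Finset I → ℤ) (hμA : IsMobius A μA)
    (μB : Finset I → Finset I → ℤ) (hμB : IsMobius B μB)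
    (H : (c : Finset I) → Ea E c → ℝ) :
    ∃ (Ht : (c : Finset I) → Ea E c → ℝ) (g : Fam E A → Fam E B),
      Set.BijOn g
        {Q : Fam E A | IsCritical E A (BT E A μA H) Q}
        {Q : Fam E B | IsCritical E B (BT E B μB Ht) Q} := by
  subst hB
  obtain ⟨Ht, hR⟩ := s19_list E as A hchain hsteps H
  have hch : ChainsShort (eraseList A as) := fun a ha b hb c hc =>
    hchain a (hR.1 ha) b (hR.1 hb) c (hR.1 hc)
  exact ⟨Ht, s19_final E hchain hch hμA hμB H Ht hR⟩
end
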